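/- Let p be a prime. Any two separably closed fields of characteristic p, each of which is infinite-dimensional as a vector space over its subfield of p-th powers, are elementarily equivalent in the first-order language of rings. -/

import Mathlib

open FirstOrder Language

attribute [local instance] FirstOrder.Ring.compatibleRingOfRing

section

open Filter Polynomial

section Saturation

/-- Countable saturation of ultraproducts over a nonprincipal ultrafilter on `ℕ`. -/
theorem exists_eventually_hyperfilter {X ι : Type*} [Countable ι] (C : ι → ℕ → Set X)
    (hC : ∀ S : Finset ι, ∃ y : ℕ → X, ∀ k ∈ S, ∀ᶠ s in (hyperfilter ℕ : Filter ℕ), y s ∈ C k s) :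
    ∃ y : ℕ → X, ∀ k, ∀ᶠ s in (hyperfilter ℕ : Filter ℕ), y s ∈ C k s := by
  classical
  obtain ⟨e, he⟩ := exists_injective_nat ι
  let T : ℕ → Finset ι := fun n ↦
    (Set.Finite.preimage he.injOn (Set.finite_Iio n)).toFinset
  have hT : ∀ n k, k ∈ T n ↔ e k < n := fun n k ↦ by simp [T]
  let P : ℕ → ℕ → Prop := fun s n ↦ ∃ y, ∀ k ∈ T n, y ∈ C k s
  obtain ⟨y₀, -⟩ := hC ∅
  have hP0 : ∀ s, P s 0 := fun s ↦ ⟨y₀ s, fun k hk ↦ by simp [hT] at hk⟩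
  have hP : ∀ n, ∀ᶠ s in (hyperfilter ℕ : Filter ℕ), P s n := by
    intro n
    obtain ⟨y, hy⟩ := hC (T n)
    filter_upwards [(eventually_all_finset (T n)).2 hy] with s hs using ⟨y s, hs⟩
  let N : ℕ → ℕ := fun s ↦ Nat.findGreatest (P s) s
  have hN : ∀ s, P s (N s) := fun s ↦ Nat.findGreatest_spec (Nat.zero_le s) (hP0 s)
  choose y hy using hN
  refine ⟨y, fun k ↦ ?_⟩
  have hlarge : ∀ᶠ s in (hyperfilter ℕ : Filter ℕ), e k + 1 ≤ s :=
    (Nat.hyperfilter_le_atTop) (eventually_ge_atTop _)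
  filter_upwards [hP (e k + 1), hlarge] with s h1 h2
  exact hy s k ((hT _ _).2 (Nat.le_findGreatest h2 h1))

end Saturation

section Germ

variable {M : Type*} [Field M]

/-- The ultrapower of `M` by a nonprincipal ultrafilter on `ℕ`. -/
abbrev Ult (M : Type*) := Filter.Germ (hyperfilter ℕ : Filter ℕ) M

theorem exists_root_of_derivative_ne_zero [IsSepClosed M] (f : M[X]) (hf : derivative f ≠ 0) :
    ∃ x, f.eval x = 0 := by
  induction f using UniqueFactorizationMonoid.induction_on_prime with
  | h₁ => simp at hf
  | h₂ u hu =>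
    obtain ⟨c, -, rfl⟩ := Polynomial.isUnit_iff.1 hu
    simp at hf
  | h₃ a q ha hq ih =>
    by_cases hq' : derivative q = 0
    · have : derivative a ≠ 0 := by
        rintro h
        exact hf (by simp [derivative_mul, h, hq'])
      obtain ⟨x, hx⟩ := ih this
      exact ⟨x, by simp [hx]⟩
    · obtain ⟨x, hx⟩ := IsSepClosed.exists_root q
        (Polynomial.degree_pos_of_irreducible hq.irreducible).ne'
        ((separable_iff_derivative_ne_zero hq.irreducible).2 hq')
      exact ⟨x, by simp [hx.eq_zero]⟩

theorem germ_coe_sum {ι : Type*} (S : Finset ι) (f : ι → ℕ → M) :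
    ((fun s ↦ ∑ i ∈ S, f i s : ℕ → M) : Ult M) = ∑ i ∈ S, (f i : Ult M) := by
  classical
  induction S using Finset.induction_on with
  | empty => simp; rfl
  | insert a S ha ih => rw [Finset.sum_insert ha, ← ih, ← Germ.coe_add]; simp [Finset.sum_insert ha]; rfl

omit [Field M] in
theorem germ_exists_rep : ∃ r : (Ult M) → ℕ → M, ∀ x, (r x : Ult M) = x :=
  ⟨fun x ↦ x.out, fun x ↦ Quotient.out_eq x⟩

instance germ_isSepClosed [IsSepClosed M] : IsSepClosed (Ult M) := by
  refine IsSepClosed.of_exists_root _ fun f _ hirr hsep ↦ ?_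
  obtain ⟨r, hr⟩ := germ_exists_rep (M := M)
  have hd : derivative f ≠ 0 := (separable_iff_derivative_ne_zero hirr).1 hsep
  obtain ⟨n, hn⟩ : ∃ n, (derivative f).coeff n ≠ 0 := by
    by_contra! h
    exact hd (Polynomial.ext (by simpa using h))
  let g : ℕ → M[X] := fun s ↦ ∑ i ∈ Finset.range (f.natDegree + 1), monomial i (r (f.coeff i) s)
  have hne : ∀ᶠ s in (hyperfilter ℕ : Filter ℕ), derivative (g s) ≠ 0 := by
    rw [coeff_derivative] at hn
    have hdeg : n + 1 ∈ Finset.range (f.natDegree + 1) := by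
      rw [Finset.mem_range, Nat.lt_succ_iff]
      exact le_natDegree_of_ne_zero (left_ne_zero_of_mul hn)
    have : ∀ᶠ s in (hyperfilter ℕ : Filter ℕ), r (f.coeff (n + 1)) s * (n + 1) ≠ 0 := by
      refine Ultrafilter.eventually_not.2 ?_
      intro h
      apply hn
      rw [← hr (f.coeff (n + 1))]
      exact Germ.coe_eq.2 h
    filter_upwards [this] with s hs h0
    apply hs
    have := congrArg (fun q ↦ coeff q n) h0
    simpa [g, coeff_derivative, coeff_monomial, hdeg, finsetSum_coeff, -Finset.mem_range] using this
  have : ∀ s, ∃ x, derivative (g s) ≠ 0 → (g s).eval x = 0 := fun s ↦ by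
    by_cases h : derivative (g s) = 0
    · exact ⟨0, fun h' ↦ (h' h).elim⟩
    · obtain ⟨x, hx⟩ := exists_root_of_derivative_ne_zero _ h
      exact ⟨x, fun _ ↦ hx⟩
  choose x hx using this
  refine ⟨(x : Ult M), ?_⟩
  rw [eval_eq_sum_range]
  have h1 : ∀ i, f.coeff i * (x : Ult M) ^ i = ((fun s ↦ r (f.coeff i) s * x s ^ i : ℕ → M) : Ult M) := by
    intro i
    conv_lhs => rw [← hr (f.coeff i)]
    rfl
  simp_rw [h1]
  rw [← germ_coe_sum]
  refine Germ.coe_eq.2 ?_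
  filter_upwards [hne] with s hs
  have := hx s hs
  simpa [g, eval_finsetSum] using this

theorem germ_elementarilyEquivalent : M ≅[Language.ring] (Ult M) := by
  have h1 : M ≅[Language.ring] ((hyperfilter ℕ : Filter ℕ).Product fun _ ↦ M) := by
    rw [elementarilyEquivalent_iff]
    intro φ
    rw [Ultraproduct.sentence_realize]
    simp
  let e : ((hyperfilter ℕ : Filter ℕ).Product fun _ ↦ M) ≃[Language.ring] (Ult M) :=
    { toEquiv := Equiv.refl _
      map_fun' := by
        intro n f x
        obtain ⟨y, rfl⟩ : ∃ y : Fin n → ℕ → M, x = fun i ↦ ((y i : Ult M)) :=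
          ⟨fun i ↦ (x i).out, funext fun i ↦ (Quotient.out_eq (x i)).symm⟩
        refine (Ultraproduct.funMap_cast (u := hyperfilter ℕ) (M := fun _ ↦ M) f y).trans ?_
        cases f <;> rfl
      map_rel' := by
        intro n r
        cases r }
  exact h1.trans (StrongHomClass.elementarilyEquivalent e)

end Germ

section BackAndForth

variable {K₁ K₂ : Type*} [Field K₁] [Field K₂]

theorem realize_term_ringHom {F K α : Type*} [Field F] [Field K] (i : F →+* K)
    (t : Language.ring.Term α) (v : α → F) : t.realize (i ∘ v) = i (t.realize v) := by
  induction t with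
  | var => rfl
  | func f ts ih =>
    cases f <;> simp [Term.realize, ih, Structure.funMap]

/-- The one-sided extension property of a back-and-forth system of pairs of embeddings of a field. -/
def ForthProperty (P : ∀ (F : Type) [Field F], (F →+* K₁) → (F →+* K₂) → Prop) : Prop :=
  ∀ (F : Type) [Field F] (i₁ : F →+* K₁) (i₂ : F →+* K₂), P F i₁ i₂ → ∀ a : K₁,
    ∃ (F' : Type) (_ : Field F') (j : F →+* F') (i₁' : F' →+* K₁) (i₂' : F' →+* K₂),
      P F' i₁' i₂' ∧ i₁'.comp j = i₁ ∧ i₂'.comp j = i₂ ∧ a ∈ Set.range i₁'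

theorem realize_iff_of_backAndForth
    {P : ∀ (F : Type) [Field F], (F →+* K₁) → (F →+* K₂) → Prop}
    (forth : ForthProperty P) (back : ForthProperty fun F _ i₂ i₁ ↦ P F i₁ i₂)
    {α : Type*} {n : ℕ} (φ : Language.ring.BoundedFormula α n) :
    ∀ (F : Type) [Field F] (i₁ : F →+* K₁) (i₂ : F →+* K₂), P F i₁ i₂ →
      ∀ (v : α → F) (x : Fin n → F),
        φ.Realize (i₁ ∘ v) (i₁ ∘ x) ↔ φ.Realize (i₂ ∘ v) (i₂ ∘ x) := by
  induction φ with
  | falsum => intros; rfl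
  | equal t₁ t₂ =>
    intro F _ i₁ i₂ _ v x
    simp only [BoundedFormula.Realize, ← Sum.comp_elim, realize_term_ringHom,
      i₁.injective.eq_iff, i₂.injective.eq_iff]
  | rel r => cases r
  | imp _ _ ih₁ ih₂ =>
    intro F _ i₁ i₂ h v x
    simp only [BoundedFormula.Realize, ih₁ F i₁ i₂ h, ih₂ F i₁ i₂ h]
  | all φ ih =>
    intro F _ i₁ i₂ h v x
    simp only [BoundedFormula.Realize]
    constructor
    · intro H a
      obtain ⟨F', _, j, i₂', i₁', h', rfl, rfl, b, rfl⟩ := back F i₂ i₁ h a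
      have := (ih F' i₁' i₂' h' (j ∘ v) (Fin.snoc (j ∘ x) b)).1 (by
        rw [Fin.comp_snoc]; exact H (i₁' b))
      rwa [Fin.comp_snoc] at this
    · intro H a
      obtain ⟨F', _, j, i₁', i₂', h', rfl, rfl, b, rfl⟩ := forth F i₁ i₂ h a
      have := (ih F' i₁' i₂' h' (j ∘ v) (Fin.snoc (j ∘ x) b)).2 (by
        rw [Fin.comp_snoc]; exact H (i₂' b))
      rwa [Fin.comp_snoc] at this

theorem elementarilyEquivalent_of_backAndForth
    {P : ∀ (F : Type) [Field F], (F →+* K₁) → (F →+* K₂) → Prop}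
    (forth : ForthProperty P) (back : ForthProperty fun F _ i₂ i₁ ↦ P F i₁ i₂)
    (F : Type) [Field F] (i₁ : F →+* K₁) (i₂ : F →+* K₂) (h : P F i₁ i₂) :
    K₁ ≅[Language.ring] K₂ := by
  rw [elementarilyEquivalent_iff]
  intro φ
  have := realize_iff_of_backAndForth forth back φ F i₁ i₂ h default default
  simp only [Sentence.Realize, Formula.Realize]
  convert this

end BackAndForth

section Separable

/-- A finite family in `K` is `p`-th power independent if it is linearly independent
over the `p`-th powers of `K`. -/
def PowIndependent (p : ℕ) {K ι : Type*} [Field K] [Fintype ι] (x : ι → K) : Prop :=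
  ∀ c : ι → K, ∑ j, c j ^ p * x j = 0 → ∀ j, c j = 0

/-- An embedding of fields `F → K` is separable if it preserves linear independence over the
subfields of `p`-th powers. -/
def SepHom (p : ℕ) {F K : Type*} [Field F] [Field K] (i : F →+* K) : Prop :=
  ∀ (n : ℕ) (x : Fin n → F), PowIndependent p x → PowIndependent p (i ∘ x)

/-- Mac Lane's criterion: `p`-th powers preserve linear independence over `F`. -/
def MacLane (p : ℕ) (F K : Type*) [Field F] [Field K] [Algebra F K] : Prop :=
  ∀ s : Finset K, LinearIndepOn F _root_.id (s : Set K) → LinearIndepOn F (· ^ p) (s : Set K)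

theorem powIndependent_comp_equiv {p : ℕ} {K ι κ : Type*} [Field K] [Fintype ι] [Fintype κ]
    (e : ι ≃ κ) (x : κ → K) (h : PowIndependent p (x ∘ e)) : PowIndependent p x := by
  intro c hc j
  have := h (c ∘ e) (by simpa using (e.sum_comp fun j ↦ c j ^ p * x j).trans hc) (e.symm j)
  simpa using this

theorem SepHom.powIndependent {p : ℕ} {F K : Type*} [Field F] [Field K] {i : F →+* K}
    (hi : SepHom p i) {ι : Type*} [Fintype ι] {x : ι → F} (hx : PowIndependent p x) :
    PowIndependent p (i ∘ x) := by
  let e := Fintype.equivFin ι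
  exact powIndependent_comp_equiv e.symm _ (hi _ (x ∘ e.symm)
    (powIndependent_comp_equiv e _ (by simpa [Function.comp_assoc] using hx)))

variable {p : ℕ} [Fact p.Prime] {F K : Type*} [Field F] [Field K] [Algebra F K]

omit [Fact p.Prime] in
theorem MacLane.linearIndependent (h : MacLane p F K) {ι : Type*} {x : ι → K}
    (hx : LinearIndependent F x) : LinearIndependent F fun j ↦ x j ^ p := by
  classical
  rw [linearIndependent_iff_finset_linearIndependent]
  intro s
  have h1 : LinearIndepOn F _root_.id ((s.image x : Finset K) : Set K) := by
    have := hx.linearIndepOn_id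
    exact this.mono (by simp)
  have h2 := h _ h1
  have := LinearIndependent.comp h2 (fun j : s ↦ ⟨x j, by simp; exact ⟨j, j.2, rfl⟩⟩) (by
    intro a b hab
    simp at hab
    exact Subtype.ext (hx.injective hab))
  exact this

variable [CharP K p]

theorem MacLane.sepHom (h : MacLane p F K) : SepHom p (algebraMap F K) := by
  classical
  intro n f hf c hc
  let b := Module.Basis.ofVectorSpace F K
  have hb := h.linearIndependent b.linearIndependent
  let S : Finset _ := Finset.univ.biUnion fun j : Fin n ↦ (b.repr (c j)).support
  have hc' : ∀ j, c j = ∑ k ∈ S, b.repr (c j) k • b k := by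
    intro j
    conv_lhs => rw [← b.linearCombination_repr (c j), Finsupp.linearCombination_apply]
    exact Finsupp.sum_of_support_subset _
      (Finset.subset_biUnion_of_mem (fun j : Fin n ↦ (b.repr (c j)).support) (Finset.mem_univ j)) _ (by simp)
  have key : ∑ k ∈ S, (∑ j, b.repr (c j) k ^ p * f j) • b k ^ p = 0 := by
    rw [← hc]
    simp_rw [Finset.sum_smul]
    rw [Finset.sum_comm]
    refine Finset.sum_congr rfl fun j _ ↦ ?_
    conv_rhs => rw [hc' j, sum_pow_char, Finset.sum_mul]
    refine Finset.sum_congr rfl fun k _ ↦ ?_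
    simp [Algebra.smul_def, mul_pow]
    ring
  have h0 := linearIndependent_iff'.1 hb S _ key
  intro j
  rw [hc' j]
  refine Finset.sum_eq_zero fun k hk ↦ ?_
  rw [hf _ (h0 k hk) j, zero_smul]

theorem SepHom.macLane [CharP F p] (h : SepHom p (algebraMap F K)) : MacLane p F K := by
  classical
  intro s hs
  rw [linearIndepOn_finset_iff] at hs ⊢
  intro g hg
  let b := Module.Basis.ofVectorSpace (frobenius F p).fieldRange F
  let r : (frobenius F p).fieldRange → F := fun y ↦ y.2.choose
  have hr : ∀ y : (frobenius F p).fieldRange, r y ^ p = y := fun y ↦ y.2.choose_spec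
  let S : Finset _ := s.biUnion fun x ↦ (b.repr (g x)).support
  have hg' : ∀ x ∈ s, g x = ∑ k ∈ S, r (b.repr (g x) k) ^ p * b k := by
    intro x hx
    conv_lhs => rw [← b.linearCombination_repr (g x), Finsupp.linearCombination_apply]
    rw [Finsupp.sum_of_support_subset _
      (Finset.subset_biUnion_of_mem (fun x ↦ (b.repr (g x)).support) hx) _ (by simp)]
    refine Finset.sum_congr rfl fun k _ ↦ ?_
    rw [hr]; rfl
  have hb : PowIndependent p fun k : S ↦ b k := by
    intro d hd
    have := linearIndependent_iff'.1 b.linearIndependent S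
      (fun k ↦ if hk : k ∈ S then ⟨d ⟨k, hk⟩ ^ p, ⟨d ⟨k, hk⟩, rfl⟩⟩ else 0) (by
        rw [← hd, ← Finset.sum_coe_sort S]
        refine Finset.sum_congr rfl fun k _ ↦ ?_
        simp [k.2]; rfl)
    intro j
    have := this j j.2
    simp only [j.2, dif_pos] at this
    have := congrArg Subtype.val this
    exact pow_eq_zero_iff (Fact.out : p.Prime).ne_zero |>.1 this
  have key := h.powIndependent hb (fun k ↦ ∑ x ∈ s, algebraMap F K (r (b.repr (g x) k)) * x) (by
    rw [← hg]
    simp_rw [sum_pow_char, Finset.sum_mul]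
    rw [Finset.sum_comm]
    refine Finset.sum_congr rfl fun x hx ↦ ?_
    conv_rhs => rw [hg' x hx, Algebra.smul_def, map_sum, Finset.sum_mul, ← Finset.sum_coe_sort S]
    refine Finset.sum_congr rfl fun k _ ↦ ?_
    simp [mul_pow]
    ring)
  intro x hx
  rw [hg' x hx]
  refine Finset.sum_eq_zero fun k hk ↦ ?_
  rw [hs (fun x ↦ r (b.repr (g x) k)) (by simpa [Algebra.smul_def] using key ⟨k, hk⟩) x hx,
    zero_pow (Fact.out : p.Prime).ne_zero,
    zero_mul]

end Separable

section MacLaneExtension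

/-- Descent of linear independence along a spanning family of scalars. -/
theorem linearIndependent_of_smul_of_span_eq_top {F R V ι κ : Type*} [Field F] [CommRing R]
    [AddCommGroup V] [Algebra F R] [Module F V] [Module R V] [IsScalarTower F R V]
    {w : ι → R} (hw : Submodule.span F (Set.range w) = ⊤) {c : κ → V}
    (h : LinearIndependent F fun q : ι × κ ↦ w q.1 • c q.2) : LinearIndependent R c := by
  classical
  rw [linearIndependent_iff']
  intro s g hg
  have : ∀ r : R, ∃ l : ι →₀ F, Finsupp.linearCombination F w l = r := fun r ↦
    (Finsupp.mem_span_range_iff_exists_finsupp).1 (hw ▸ Submodule.mem_top : r ∈ _)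
  choose l hl using this
  let T : Finset ι := s.biUnion fun j ↦ (l (g j)).support
  have hg' : ∀ j ∈ s, g j = ∑ i ∈ T, l (g j) i • w i := by
    intro j hj
    conv_lhs => rw [← hl (g j), Finsupp.linearCombination_apply]
    exact Finsupp.sum_of_support_subset _
      (Finset.subset_biUnion_of_mem (fun j ↦ (l (g j)).support) hj) _ (by simp)
  have key := linearIndependent_iff'.1 h (T ×ˢ s) (fun q ↦ l (g q.2) q.1) (by
    rw [Finset.sum_product_right, ← hg]
    refine Finset.sum_congr rfl fun j hj ↦ ?_
    conv_rhs => rw [hg' j hj, Finset.sum_smul]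
    simp [smul_assoc])
  intro j hj
  rw [hg' j hj]
  refine Finset.sum_eq_zero fun i hi ↦ ?_
  rw [key (i, j) (by simp [hi, hj]), zero_smul]

variable {p : ℕ} [Fact p.Prime] {F K : Type*} [Field F] [Field K] [Algebra F K]

omit [Fact p.Prime] in
theorem MacLane.of_tower {E : Type*} [Field E] [Algebra F E] [Algebra E K] [IsScalarTower F E K]
    (h : MacLane p F K) : MacLane p F E := by
  intro s hs
  have h1 : LinearIndependent F (fun x : s ↦ algebraMap E K x) :=
    LinearIndependent.map' hs (IsScalarTower.toAlgHom F E K).toLinearMap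
      (LinearMap.ker_eq_bot_of_injective (algebraMap E K).injective)
  have h2 := h.linearIndependent h1
  refine LinearIndependent.of_comp (IsScalarTower.toAlgHom F E K).toLinearMap ?_
  have heq : (IsScalarTower.toAlgHom F E K).toLinearMap ∘ (fun x : s ↦ (x : E) ^ p) =
      fun x : s ↦ algebraMap E K x ^ p := by
    ext x; simp
  exact heq ▸ h2

theorem MacLane.of_isSeparable [CharP F p] {E : Type*} [Field E] [Algebra F E] [Algebra E K]
    [IsScalarTower F E K] [Algebra.IsSeparable F E] (h : MacLane p F K) : MacLane p E K := by
  intro s hs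
  have : ExpChar F p := ExpChar.prime Fact.out
  let b := Module.Basis.ofVectorSpace F E
  have h1 := h.linearIndependent (linearIndependent_smul b.linearIndependent hs)
  refine linearIndependent_of_smul_of_span_eq_top
    (b.mapPowExpCharPowOfIsSeparable p 1).span_eq ?_
  have heq : (fun q : _ × (s : Set K) ↦ b.mapPowExpCharPowOfIsSeparable p 1 q.1 • (q.2 : K) ^ p) =
      fun q ↦ (b q.1 • _root_.id (q.2 : K)) ^ p := by
    ext q
    simp [Module.Basis.mapPowExpCharPowOfIsSeparable, Algebra.smul_def, mul_pow]
  exact heq ▸ h1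

theorem linearIndependent_pow_of_notMem [CharP K p] {L : IntermediateField F K}
    (hL : ∀ x, x ^ p ∈ L) {t : K} (ht : t ∉ L) : LinearIndependent L fun i : Fin p ↦ t ^ (i : ℕ) := by
  have hp : p.Prime := Fact.out
  have hirr : Irreducible (Polynomial.X ^ p - Polynomial.C (⟨t ^ p, hL t⟩ : L)) := by
    refine X_pow_sub_C_irreducible_of_prime hp fun b hb ↦ ht ?_
    have : (b : K) ^ p = t ^ p := congrArg Subtype.val hb
    rw [← frobenius_def, ← frobenius_def] at this
    rw [← frobenius_inj K p this]
    exact b.2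
  have hmin := minpoly.eq_of_irreducible_of_monic hirr (x := t)
    (by simp [IntermediateField.algebraMap_apply]) (Polynomial.monic_X_pow_sub_C _ hp.ne_zero)
  have := linearIndependent_pow (K := L) t
  rw [← hmin, Polynomial.natDegree_X_pow_sub_C] at this
  exact this

omit [Fact p.Prime] in
theorem MacLane.transcendental [CharP K p] (h : MacLane p F K) {L : IntermediateField F K}
    (hL : ∀ x, x ^ p ∈ L) {t : K} (ht : t ∉ L) : Transcendental F t := by
  intro halg
  have hint := halg.isIntegral
  have := IntermediateField.adjoin.finiteDimensional hint
  have h1 := (h.of_tower (E := IntermediateField.adjoin F {t})).linearIndependent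
    (linearIndependent_pow (K := F) (IntermediateField.AdjoinSimple.gen F t))
  have h2 := h1.span_eq_top_of_card_eq_finrank' (by
    rw [IntermediateField.adjoin.finrank hint, Fintype.card_fin, IntermediateField.minpoly_gen])
  have h3 : (Submodule.span F (Set.range fun j : Fin (minpoly F
      (IntermediateField.AdjoinSimple.gen F t)).natDegree ↦
      (IntermediateField.AdjoinSimple.gen F t ^ (j : ℕ)) ^ p)) ≤
      L.toSubalgebra.toSubmodule.comap (IntermediateField.val _).toLinearMap := by
    rw [Submodule.span_le]
    rintro _ ⟨j, rfl⟩
    simpa using hL (t ^ (j : ℕ))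
  have h4 := h3 (h2 ▸ Submodule.mem_top : IntermediateField.AdjoinSimple.gen F t ∈ _)
  exact ht (by simpa using h4)

open scoped IntermediateField.algebraAdjoinAdjoin in
theorem MacLane.adjoin_simple [CharP K p] (h : MacLane p F K) {L : IntermediateField F K}
    (hL : ∀ x, x ^ p ∈ L) {t : K} (ht : t ∉ L) :
    MacLane p (IntermediateField.adjoin F {t}) K := by
  have hp : p.Prime := Fact.out
  intro s hs
  have htr := h.transcendental hL ht
  have hpow : LinearIndependent F fun n : ℕ ↦ IntermediateField.AdjoinSimple.gen F t ^ n := by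
    refine LinearIndependent.of_comp (IntermediateField.val _).toLinearMap ?_
    have := (Polynomial.basisMonomials F).linearIndependent.map' (Polynomial.aeval t).toLinearMap
      (LinearMap.ker_eq_bot_of_injective (transcendental_iff_injective.1 htr))
    have heq : (IntermediateField.val _).toLinearMap ∘
        (fun n : ℕ ↦ IntermediateField.AdjoinSimple.gen F t ^ n) =
        (Polynomial.aeval t).toLinearMap ∘ Polynomial.basisMonomials F := by
      ext n
      simp
    exact heq ▸ this
  have h1 := h.linearIndependent (linearIndependent_smul hpow hs)
  have h2 : LinearIndependent F fun q : ℕ × (s : Set K) ↦ (⟨(t ^ q.1 * q.2) ^ p, hL _⟩ : L) := by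
    refine LinearIndependent.of_comp L.val.toLinearMap ?_
    have heq : L.val.toLinearMap ∘
        (fun q : ℕ × (s : Set K) ↦ (⟨(t ^ q.1 * q.2) ^ p, hL _⟩ : L)) =
        fun q ↦ (IntermediateField.AdjoinSimple.gen F t ^ q.1 • _root_.id (q.2 : K)) ^ p := by
      ext q
      simp [Algebra.smul_def, IntermediateField.algebraMap_apply]
    exact heq ▸ h1
  have h3 := linearIndependent_smul h2 (linearIndependent_pow_of_notMem hL ht)
  have h4 : LinearIndependent F fun q : ℕ × (s : Set K) ↦ t ^ q.1 * (q.2 : K) ^ p := by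
    have h := h3.comp (fun q : ℕ × (s : Set K) ↦ ((q.1 / p, q.2), ⟨q.1 % p, Nat.mod_lt _ hp.pos⟩)) (by
      rintro ⟨n, x⟩ ⟨m, y⟩ h
      simp only [Prod.mk.injEq, Fin.mk.injEq] at h
      obtain ⟨⟨h1, h2⟩, h3⟩ := h
      rw [Prod.mk.injEq]
      exact ⟨by rw [← Nat.div_add_mod n p, h1, h3, Nat.div_add_mod], h2⟩)
    convert h using 2 with q
    simp only [Function.comp, Algebra.smul_def, IntermediateField.algebraMap_apply]
    conv_lhs => rw [← Nat.div_add_mod q.1 p]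
    ring
  have h5 : LinearIndependent (Algebra.adjoin F {t}) fun x : (s : Set K) ↦ (x : K) ^ p := by
    refine linearIndependent_of_smul_of_span_eq_top (F := F)
      (w := fun n : ℕ ↦ (⟨t ^ n, pow_mem (Algebra.self_mem_adjoin_singleton F t) n⟩ :
        Algebra.adjoin F {t})) ?_ ?_
    · rw [eq_top_iff]
      rintro ⟨y, hy⟩ -
      obtain ⟨f, rfl⟩ := (Algebra.adjoin_singleton_eq_range_aeval F t) ▸ hy
      have : (⟨Polynomial.aeval t f, hy⟩ : Algebra.adjoin F {t}) = f.sum fun n a ↦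
          a • ⟨t ^ n, pow_mem (Algebra.self_mem_adjoin_singleton F t) n⟩ := by
        ext
        simp [Polynomial.sum, Polynomial.aeval_def, Polynomial.eval₂_eq_sum, Algebra.smul_def]
      refine this ▸ Submodule.sum_mem _ fun n _ ↦ Submodule.smul_mem _ _ (Submodule.subset_span ⟨n, rfl⟩)
    · exact h4
  exact (LinearIndependent.iff_fractionRing (Algebra.adjoin F {t})
    (IntermediateField.adjoin F {t})).1 h5

end MacLaneExtension

section PowerCompositum

variable (p : ℕ) [Fact p.Prime] (F K : Type*) [Field F] [Field K] [Algebra F K]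

/-- The compositum of `F` with the `p`-th powers of `K`. -/
def powCompositum : IntermediateField F K :=
  (Algebra.adjoin F (MonoidHom.mrange (powMonoidHom p : K →* K) : Set K)).toIntermediateField
    fun x hx ↦ by
      by_cases h : x = 0
      · simp [h]
      have hp : p - 1 + 1 = p := Nat.sub_add_cancel (Fact.out : p.Prime).one_le
      have : x⁻¹ = x ^ (p - 1) * x⁻¹ ^ p := by
        rw [← hp, pow_succ x⁻¹, Nat.add_sub_cancel, ← mul_assoc, ← mul_pow, mul_inv_cancel₀ h,
          one_pow, one_mul]
      rw [this]
      exact mul_mem (pow_mem hx _) (Algebra.subset_adjoin ⟨x⁻¹, rfl⟩)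

variable {F K}

theorem pow_mem_powCompositum (x : K) : x ^ p ∈ powCompositum p F K :=
  Algebra.subset_adjoin ⟨x, rfl⟩

theorem exists_of_mem_powCompositum {x : K} (hx : x ∈ powCompositum p F K) :
    ∃ (n : ℕ) (f : Fin n → F) (c : Fin n → K), ∑ j, c j ^ p * algebraMap F K (f j) = x := by
  replace hx : x ∈ Submodule.span F (MonoidHom.mrange (powMonoidHom p : K →* K) : Set K) := by
    have := Algebra.adjoin_eq_span F (MonoidHom.mrange (powMonoidHom p : K →* K) : Set K)
    rw [Submonoid.closure_eq] at this
    exact this ▸ hx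
  induction hx using Submodule.span_induction with
  | mem x h =>
    obtain ⟨y, rfl⟩ := h
    exact ⟨1, 1, fun _ ↦ y, by simp⟩
  | zero => exact ⟨0, 0, 0, by simp⟩
  | add x y _ _ hx hy =>
    obtain ⟨n, f, c, rfl⟩ := hx
    obtain ⟨m, g, d, rfl⟩ := hy
    exact ⟨n + m, Fin.append f g, Fin.append c d, by simp [Fin.sum_univ_add]⟩
  | smul a x _ hx =>
    obtain ⟨n, f, c, rfl⟩ := hx
    refine ⟨n, fun j ↦ a * f j, c, ?_⟩
    rw [Finset.smul_sum]
    refine Finset.sum_congr rfl fun j _ ↦ ?_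
    rw [map_mul, Algebra.smul_def]
    ring

end PowerCompositum

section UltrapowerDegree

variable {p : ℕ} [Fact p.Prime] {M : Type*} [Field M] [CharP M p]

theorem exists_notMem_powCompositum (hM : ¬ FiniteDimensional (frobenius M p).fieldRange M)
    (F : Type*) [Field F] [Countable F] [Algebra F (Ult M)] :
    ∃ t : Ult M, t ∉ powCompositum p F (Ult M) := by
  classical
  obtain ⟨r, hr⟩ := germ_exists_rep (M := M)
  let C : (Σ n, Fin n → F) → ℕ → Set M := fun k s ↦
    {y | ∀ c : Fin k.1 → M, ∑ j, c j ^ p * r (algebraMap F _ (k.2 j)) s ≠ y}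
  obtain ⟨y, hy⟩ := exists_eventually_hyperfilter C (by
    intro S
    have : ∀ s : ℕ, ∃ y : M, y ∉ Submodule.span (frobenius M p).fieldRange
        ((S.biUnion fun k ↦ Finset.univ.image fun j ↦ r (algebraMap F _ (k.2 j)) s : Finset M) :
          Set M) := by
      intro s
      by_contra! h
      exact hM ⟨⟨_, eq_top_iff.2 fun x _ ↦ h x⟩⟩
    choose y hy using this
    refine ⟨y, fun k hk ↦ Eventually.of_forall fun s c h ↦ hy s ?_⟩
    rw [← h]
    refine Submodule.sum_mem _ fun j _ ↦ ?_
    refine Submodule.smul_mem _ (⟨c j ^ p, ⟨c j, rfl⟩⟩ : (frobenius M p).fieldRange)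
      (Submodule.subset_span ?_)
    simp only [Finset.coe_biUnion, Set.mem_iUnion]
    exact ⟨k, hk, by simp⟩)
  refine ⟨(y : Ult M), fun h ↦ ?_⟩
  obtain ⟨n, f, c, h⟩ := exists_of_mem_powCompositum p h
  have h1 : ∀ j, c j ^ p * algebraMap F (Ult M) (f j) =
      ((fun s ↦ r (c j) s ^ p * r (algebraMap F _ (f j)) s : ℕ → M) : Ult M) := by
    intro j
    conv_lhs => rw [← hr (c j), ← hr (algebraMap F _ (f j))]
    rfl
  simp_rw [h1] at h
  rw [← germ_coe_sum] at h
  obtain ⟨s, hs, hs'⟩ := ((Germ.coe_eq.1 h).and (hy ⟨n, f⟩)).exists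
  exact hs' (fun j ↦ r (c j) s) hs

end UltrapowerDegree

section FiniteEmbedding

theorem countable_adjoin (F : Type*) {K : Type*} [Field F] [Field K] [Algebra F K] [Countable F]
    (s : Set K) [Countable s] : Countable (IntermediateField.adjoin F s) := by
  rw [← Cardinal.mk_le_aleph0_iff, ← Cardinal.lift_le_aleph0]
  refine (IntermediateField.lift_cardinalMk_adjoin_le F s).trans ?_
  simp

variable {p : ℕ} [Fact p.Prime] {F K : Type*} [Field F] [Field K] [Algebra F K] [CharP K p]

open scoped IntermediateField.algebraAdjoinAdjoin in
theorem MacLane.exists_algebraicIndependent [Countable F] (h : MacLane p F K)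
    (hK : ∀ L : IntermediateField F K, Countable L → ∃ t : K, t ∉ powCompositum p L K)
    (ι : Type*) [Finite ι] :
    ∃ x : ι → K, AlgebraicIndependent F x ∧
      MacLane p (IntermediateField.adjoin F (Set.range x)) K := by
  induction ι using Finite.induction_empty_option with
  | of_equiv e ih =>
    obtain ⟨x, hx, hx'⟩ := ih
    refine ⟨x ∘ e.symm, (algebraicIndependent_equiv e.symm).2 hx, ?_⟩
    rwa [e.symm.surjective.range_comp]
  | h_empty =>
    refine ⟨PEmpty.elim, algebraicIndependent_empty_type_iff.2 (algebraMap F K).injective, ?_⟩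
    have : CharP F p := (algebraMap F K).charP_iff (algebraMap F K).injective p |>.2 inferInstance
    rw [Set.range_eq_empty, IntermediateField.adjoin_empty]
    exact h.of_isSeparable
  | h_option ih =>
    obtain ⟨x, hx, hx'⟩ := ih
    obtain ⟨t, ht⟩ := hK _ (countable_adjoin F (Set.range x))
    have htr := hx'.transcendental (pow_mem_powCompositum p) ht
    have hmac := hx'.adjoin_simple (pow_mem_powCompositum p) ht
    refine ⟨fun o ↦ o.elim t x, (hx.option_iff_transcendental t).2 ?_, ?_⟩
    · exact htr.restrictScalars (FaithfulSMul.algebraMap_injective _ _)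
    · have := IntermediateField.adjoin_adjoin_left F (Set.range x) {t}
      have h2 : Set.range (fun o : Option _ ↦ o.elim t x) = Set.range x ∪ {t} := by
        ext y
        simp [Option.exists, eq_comm]
      rw [h2, ← this]
      exact hmac

omit [Fact p.Prime] [CharP K p] [Algebra F K] in
theorem PowIndependent.ringEquiv (e : F ≃+* K) {ι : Type*} [Fintype ι] {x : ι → F}
    (hx : PowIndependent p x) : PowIndependent p (e ∘ x) := by
  intro c hc j
  have := hx (fun j ↦ e.symm (c j)) (e.injective (by simpa using hc)) j
  simpa using this

omit [Fact p.Prime] [CharP K p] [Algebra F K] in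
theorem SepHom.comp_ringEquiv {i : F →+* K} (hi : SepHom p i) {E : Type*} [Field E]
    (e : E ≃+* F) : SepHom p (i.comp e.toRingHom) :=
  fun n _ hx ↦ hi n _ (hx.ringEquiv e)

theorem MacLane.exists_algHom_of_isSeparable [IsSepClosed K] [CharP F p] (h : MacLane p F K)
    (E : Type*) [Field E] [Algebra F E] [Algebra.IsSeparable F E] :
    ∃ φ : E →ₐ[F] K, SepHom p φ.toRingHom := by
  let φ : E →ₐ[F] K := IsSepClosed.lift
  let := φ.toRingHom.toAlgebra
  have : IsScalarTower F E K := IsScalarTower.of_algebraMap_eq fun a ↦ (φ.commutes a).symm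
  exact ⟨φ, (h.of_isSeparable (E := E)).sepHom⟩

theorem MacLane.exists_algHom [IsSepClosed K] [Countable F] (h : MacLane p F K)
    (hK : ∀ L : IntermediateField F K, Countable L → ∃ t : K, t ∉ powCompositum p L K)
    (E : Type*) [Field E] [Algebra F E] [Algebra.EssFiniteType F E] (hE : MacLane p F E) :
    ∃ φ : E →ₐ[F] K, SepHom p φ.toRingHom := by
  have : CharP F p := ((algebraMap F K).charP_iff (algebraMap F K).injective p).2 inferInstance
  have : CharP E p := ((algebraMap F E).charP_iff (algebraMap F E).injective p).1 inferInstance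
  have : ExpChar F p := ExpChar.prime Fact.out
  obtain ⟨s, hs, hsep⟩ :=
    exists_isTranscendenceBasis_and_isSeparable_of_linearIndepOn_pow_of_essFiniteType
      p (Fact.out : p.Prime) hE
  obtain ⟨x, hx, hmac⟩ := h.exists_algebraicIndependent hK s
  have hsep' : Algebra.IsSeparable
      (IntermediateField.adjoin F (Set.range ((↑) : s → E))) E := by
    rwa [Subtype.range_coe_subtype]
  let e := hs.1.aevalEquivField.symm.trans hx.aevalEquivField
  let i : IntermediateField.adjoin F (Set.range ((↑) : s → E)) →ₐ[F] K :=
    (IntermediateField.val _).comp e.toAlgHom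
  let := i.toRingHom.toAlgebra
  have : CharP (IntermediateField.adjoin F (Set.range ((↑) : s → E))) p :=
    (i.toRingHom.charP_iff i.injective p).2 inferInstance
  have hi : MacLane p (IntermediateField.adjoin F (Set.range ((↑) : s → E))) K :=
    SepHom.macLane (hmac.sepHom.comp_ringEquiv e.toRingEquiv)
  obtain ⟨φ, hφ⟩ := hi.exists_algHom_of_isSeparable E
  refine ⟨{ φ.toRingHom with commutes' := fun a ↦ ?_ }, hφ⟩
  exact (φ.commutes (algebraMap F _ a)).trans (i.commutes a)

end FiniteEmbedding

section CountableEmbedding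

variable {p : ℕ} {M : Type*} [Field M]

theorem germ_sum_pow_mul {ι : Type*} [Fintype ι] (c y : ι → ℕ → M) :
    ∑ j, (c j : Ult M) ^ p * (y j : Ult M) = ((fun s ↦ ∑ j, c j s ^ p * y j s : ℕ → M) : Ult M) := by
  rw [germ_coe_sum]
  rfl

theorem powIndependent_germ {ι : Type*} [Fintype ι] {y : ι → ℕ → M} :
    PowIndependent p (fun j ↦ (y j : Ult M)) ↔
      ∀ᶠ s in (hyperfilter ℕ : Filter ℕ), PowIndependent p (fun j ↦ y j s) := by
  constructor
  · intro h
    by_contra hne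
    have hev := Ultrafilter.eventually_not.2 hne
    have : ∀ s, ∃ c : ι → M, ¬ PowIndependent p (fun j ↦ y j s) →
        ∑ j, c j ^ p * y j s = 0 ∧ ∃ j, c j ≠ 0 := by
      intro s
      by_cases hs : PowIndependent p (fun j ↦ y j s)
      · exact ⟨0, fun h ↦ (h hs).elim⟩
      · simp only [PowIndependent, not_forall] at hs
        obtain ⟨c, hc, j, hj⟩ := hs
        exact ⟨c, fun _ ↦ ⟨hc, j, hj⟩⟩
    choose c hc using this
    have h0 := h (fun j ↦ ((fun s ↦ c s j : ℕ → M) : Ult M)) (by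
      rw [germ_sum_pow_mul]
      refine Germ.coe_eq.2 ?_
      filter_upwards [hev] with s hs using (hc s hs).1)
    have h1 : ∀ᶠ s in (hyperfilter ℕ : Filter ℕ), ∀ j, c s j = 0 :=
      eventually_all.2 fun j ↦ Germ.coe_eq.1 (h0 j)
    obtain ⟨s, hs, hs'⟩ := (hev.and h1).exists
    obtain ⟨j, hj⟩ := (hc s hs).2
    exact hj (hs' j)
  · intro h c hc j
    obtain ⟨r, hr⟩ := germ_exists_rep (M := M)
    have h1 : ∑ j, (r (c j) : Ult M) ^ p * (y j : Ult M) = 0 := by simpa only [hr] using hc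
    rw [germ_sum_pow_mul] at h1
    rw [← hr (c j)]
    refine Germ.coe_eq.2 ?_
    filter_upwards [h, Germ.coe_eq.1 h1] with s hs hs' using hs _ hs' j

theorem MacLane.exists_algHom_germ [Fact p.Prime] [CharP M p] [IsSepClosed M]
    (hM : ¬ FiniteDimensional (frobenius M p).fieldRange M) {F E : Type*} [Field F] [Field E]
    [Countable F] [Countable E] [Algebra F E] [Algebra F (Ult M)] [CharP (Ult M) p]
    (hE : MacLane p F E) (h : MacLane p F (Ult M)) :
    ∃ φ : E →ₐ[F] Ult M, SepHom p φ.toRingHom := by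
  classical
  obtain ⟨r, hr⟩ := germ_exists_rep (M := M)
  let C : (E × E) ⊕ (E × E) ⊕ F ⊕ (Σ n, Fin n → E) → ℕ → Set (E → M) := fun k s ↦
    match k with
    | .inl (a, b) => {y | y (a + b) = y a + y b}
    | .inr (.inl (a, b)) => {y | y (a * b) = y a * y b}
    | .inr (.inr (.inl f)) => {y | y (algebraMap F E f) = r (algebraMap F _ f) s}
    | .inr (.inr (.inr ⟨_, x⟩)) => {y | PowIndependent p x → PowIndependent p fun j ↦ y (x j)}
  obtain ⟨y, hy⟩ := exists_eventually_hyperfilter C (by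
    intro S
    let Z : Finset E := S.biUnion fun k ↦
      match k with
      | .inl (a, b) => {a, b}
      | .inr (.inl (a, b)) => {a, b}
      | .inr (.inr (.inl _)) => ∅
      | .inr (.inr (.inr ⟨_, x⟩)) => Finset.univ.image x
    let L : IntermediateField F E := IntermediateField.adjoin F (Z : Set E)
    have hZ : ∀ z ∈ Z, z ∈ L := fun z hz ↦ IntermediateField.subset_adjoin F _ hz
    have : Algebra.EssFiniteType F L :=
      IntermediateField.essFiniteType_iff.2 (IntermediateField.fg_adjoin_finset Z)
    obtain ⟨g, hg⟩ := h.exists_algHom (fun L _ ↦ exists_notMem_powCompositum hM L) L hE.of_tower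
    let y : ℕ → E → M := fun s a ↦ if ha : a ∈ L then r (g ⟨a, ha⟩) s else 0
    have hy : ∀ a (ha : a ∈ L), ((fun s ↦ y s a : ℕ → M) : Ult M) = g ⟨a, ha⟩ := by
      intro a ha
      simp only [y, ha, dif_pos]
      exact hr _
    refine ⟨y, ?_⟩
    rintro (⟨a, b⟩ | ⟨a, b⟩ | f | ⟨n, x⟩) hk
    · have ha : a ∈ L := hZ _ (Finset.mem_biUnion.2 ⟨_, hk, by simp⟩)
      have hb : b ∈ L := hZ _ (Finset.mem_biUnion.2 ⟨_, hk, by simp⟩)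
      have : ((fun s ↦ y s (a + b) : ℕ → M) : Ult M) =
          (((fun s ↦ y s a) + (fun s ↦ y s b) : ℕ → M) : Ult M) := by
        rw [Germ.coe_add, hy _ ha, hy _ hb, hy _ (add_mem ha hb), ← map_add]
        rfl
      exact Germ.coe_eq.1 this
    · have ha : a ∈ L := hZ _ (Finset.mem_biUnion.2 ⟨_, hk, by simp⟩)
      have hb : b ∈ L := hZ _ (Finset.mem_biUnion.2 ⟨_, hk, by simp⟩)
      have : ((fun s ↦ y s (a * b) : ℕ → M) : Ult M) =
          (((fun s ↦ y s a) * (fun s ↦ y s b) : ℕ → M) : Ult M) := by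
        rw [Germ.coe_mul, hy _ ha, hy _ hb, hy _ (mul_mem ha hb), ← map_mul]
        rfl
      exact Germ.coe_eq.1 this
    · refine Eventually.of_forall fun s ↦ ?_
      simp [C, y, L.algebraMap_mem f]
    · have hx : ∀ j, x j ∈ L := fun j ↦ hZ _ (Finset.mem_biUnion.2 ⟨_, hk, by simp⟩)
      by_cases hind : PowIndependent p x
      · have hind' : PowIndependent p fun j ↦ (⟨x j, hx j⟩ : L) := by
          intro c hc j
          have := hind (fun j ↦ c j) (by simpa using congrArg Subtype.val hc) j
          exact Subtype.ext this
        have h1 := hg _ _ hind'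
        have h2 : PowIndependent p fun j ↦ ((fun s ↦ y s (x j) : ℕ → M) : Ult M) := by
          simp_rw [hy _ (hx _)]
          exact h1
        filter_upwards [powIndependent_germ.1 h2] with s hs _ using hs
      · exact Eventually.of_forall fun s h ↦ (hind h).elim)
  let φ : E → Ult M := fun a ↦ ((fun s ↦ y s a : ℕ → M) : Ult M)
  have hF : ∀ f, φ (algebraMap F E f) = algebraMap F _ f := by
    intro f
    rw [← hr (algebraMap F _ f)]
    exact Germ.coe_eq.2 (hy (.inr (.inr (.inl f))))
  refine ⟨
    { toFun := φ
      map_one' := by simpa using hF 1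
      map_zero' := by simpa using hF 0
      map_add' := fun a b ↦ Germ.coe_eq.2 (hy (.inl (a, b)))
      map_mul' := fun a b ↦ Germ.coe_eq.2 (hy (.inr (.inl (a, b))))
      commutes' := hF }, fun n x hx ↦ ?_⟩
  refine powIndependent_germ.2 ?_
  filter_upwards [hy (.inr (.inr (.inr ⟨n, x⟩)))] with s hs using hs hx

end CountableEmbedding

section Hull

theorem countable_subfield_closure {K : Type*} [Field K] {s : Set K} (hs : s.Countable) :
    Countable (Subfield.closure s) := by
  rw [← Cardinal.mk_le_aleph0_iff]
  refine (Subfield.cardinalMk_closure_le_max s).trans ?_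
  simpa using hs

variable {p : ℕ} {K : Type*} [Field K]

theorem exists_countable_subfield_sepHom {A : Set K} (hA : A.Countable) :
    ∃ L : Subfield K, Countable L ∧ A ⊆ L ∧ SepHom p L.subtype := by
  have : ∀ (n : ℕ) (x : Fin n → K), ∃ c : Fin n → K, ¬ PowIndependent p x →
      ∑ j, c j ^ p * x j = 0 ∧ ∃ j, c j ≠ 0 := by
    intro n x
    by_cases h : PowIndependent p x
    · exact ⟨0, fun h' ↦ (h' h).elim⟩
    · simp only [PowIndependent, not_forall] at h
      obtain ⟨c, hc, j, hj⟩ := h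
      exact ⟨c, fun _ ↦ ⟨hc, j, hj⟩⟩
  choose w hw using this
  let next : Subfield K → Subfield K := fun B ↦ Subfield.closure
    (B ∪ ⋃ k : Σ n, Fin n → B, Set.range (w k.1 fun j ↦ k.2 j))
  let B : ℕ → Subfield K := fun m ↦ next^[m] (Subfield.closure A)
  have hB : ∀ m, B (m + 1) = next (B m) := fun m ↦ Function.iterate_succ_apply' _ _ _
  have hmono : Monotone B := monotone_nat_of_le_succ fun m ↦ by
    rw [hB]
    exact fun x hx ↦ Subfield.subset_closure (Or.inl hx)
  have hcount : ∀ m, Countable (B m) := by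
    intro m
    induction m with
    | zero => exact countable_subfield_closure hA
    | succ m ih =>
      rw [hB]
      exact countable_subfield_closure
        ((Set.to_countable _).union (Set.countable_iUnion fun _ ↦ Set.countable_range _))
  have hmem : ∀ x, x ∈ ⨆ m, B m ↔ ∃ m, x ∈ B m := fun x ↦
    Subfield.mem_iSup_of_directed hmono.directed_le
  refine ⟨⨆ m, B m, ?_, ?_, ?_⟩
  · have : ((⨆ m, B m : Subfield K) : Set K) = ⋃ m, (B m : Set K) := by
      ext x
      simp [hmem]
    exact Set.countable_coe_iff.2 (this ▸ Set.countable_iUnion fun m ↦ Set.to_countable _)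
  · exact fun x hx ↦ (hmem x).2 ⟨0, Subfield.subset_closure hx⟩
  · intro n x hx
    by_contra hne
    have : ∀ j, ∃ m, (x j : K) ∈ B m := fun j ↦ (hmem _).1 (x j).2
    choose m hm using this
    have hm' : ∀ j, (x j : K) ∈ B (Finset.univ.sup m) := fun j ↦
      hmono (Finset.le_sup (Finset.mem_univ j)) (hm j)
    obtain ⟨h0, j, hj⟩ := hw n _ hne
    have hwmem : ∀ j, w n (fun j ↦ x j) j ∈ ⨆ m, B m := by
      refine fun j ↦ (hmem _).2 ⟨Finset.univ.sup m + 1, ?_⟩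
      rw [hB]
      exact Subfield.subset_closure
        (Or.inr (Set.mem_iUnion.2 ⟨⟨n, fun j ↦ ⟨x j, hm' j⟩⟩, j, rfl⟩))
    have := hx (fun j ↦ ⟨w n (fun j ↦ x j) j, hwmem j⟩) (by
      ext
      simpa [Function.comp_def] using h0) j
    exact hj (congrArg Subtype.val this)

end Hull

section Ershov

variable {p : ℕ} [Fact p.Prime]

instance germ_charP {M : Type*} [Field M] [CharP M p] : CharP (Ult M) p :=
  charP_of_injective_ringHom
    (f := (Germ.coeRingHom (hyperfilter ℕ : Filter ℕ)).comp (Pi.constRingHom ℕ M))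
    (RingHom.injective _) p

theorem forthProperty_sepHom {M K : Type*} [Field M] [Field K] [CharP M p] [CharP K p]
    [IsSepClosed M] (hM : ¬ FiniteDimensional (frobenius M p).fieldRange M) :
    ForthProperty fun F _ (i₁ : F →+* K) (i₂ : F →+* Ult M) ↦
      Countable F ∧ SepHom p i₁ ∧ SepHom p i₂ := by
  rintro F _ i₁ i₂ ⟨hF, h₁, h₂⟩ a
  obtain ⟨L, hL, hAL, hsep⟩ := exists_countable_subfield_sepHom (p := p)
    ((Set.countable_range i₁).union (Set.countable_singleton a))
  have hi₁ : ∀ x, i₁ x ∈ L := fun x ↦ hAL (Or.inl ⟨x, rfl⟩)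
  have : CharP F p := (i₁.charP_iff i₁.injective p).2 inferInstance
  let := i₁.toAlgebra
  let := i₂.toAlgebra
  let := (i₁.codRestrict L hi₁).toAlgebra
  have : IsScalarTower F L K := IsScalarTower.of_algebraMap_eq fun _ ↦ rfl
  have hFK : MacLane p F K := SepHom.macLane h₁
  have hFM : MacLane p F (Ult M) := SepHom.macLane h₂
  obtain ⟨φ, hφ⟩ := MacLane.exists_algHom_germ hM (hFK.of_tower (E := L)) hFM
  obtain ⟨F', _, ⟨e⟩⟩ : ∃ (F' : Type) (_ : Field F'), Nonempty (F' ≃+* L) :=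
    ⟨Shrink.{0} L, inferInstance, ⟨Shrink.ringEquiv.{0} L⟩⟩
  refine ⟨F', inferInstance, e.symm.toRingHom.comp (i₁.codRestrict L hi₁),
    L.subtype.comp e.toRingHom, φ.toRingHom.comp e.toRingHom,
    ⟨e.toEquiv.countable_iff.2 hL, hsep.comp_ringEquiv e, hφ.comp_ringEquiv e⟩, ?_, ?_, ?_⟩
  · ext x
    simp
  · ext x
    have := φ.commutes x
    simpa [RingHom.algebraMap_toAlgebra] using this
  · exact ⟨e.symm ⟨a, hAL (Or.inr rfl)⟩, by simp⟩

theorem macLane_of_perfectField {F K : Type*} [Field F] [Field K] [Algebra F K] [CharP F p]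
    [CharP K p] [PerfectRing F p] : MacLane p F K := by
  intro s hs
  refine hs.map_of_injective_injective (frobeniusEquiv F p).symm (frobenius K p).toAddMonoidHom
    (by simp) (by simp) fun r m ↦ ?_
  change ((frobeniusEquiv F p).symm r • m) ^ p = r • m ^ p
  rw [Algebra.smul_def, Algebra.smul_def, mul_pow, ← map_pow, frobeniusEquiv_symm_pow_p]

end Ershov

end

/-- Ershov's completeness theorem for `SCF_p^∞`: any two separably closed fields of
characteristic `p`, each infinite-dimensional over its subfield of `p`-th powers (i.e. of
infinite degree of imperfection), are elementarily equivalent in the language of rings. -/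
theorem scf_infinite_imperfection_elementarilyEquivalent
    (p : ℕ) [Fact p.Prime]
    (K₁ : Type*) (K₂ : Type*) [Field K₁] [Field K₂] [CharP K₁ p] [CharP K₂ p]
    [IsSepClosed K₁] [IsSepClosed K₂]
    (h₁ : ¬ FiniteDimensional ((frobenius K₁ p).fieldRange) K₁)
    (h₂ : ¬ FiniteDimensional ((frobenius K₂ p).fieldRange) K₂) :
    K₁ ≅[Language.ring] K₂ := by
  let := ZMod.algebra (Ult K₁) p
  let := ZMod.algebra (Ult K₂) p
  have back : ForthProperty fun F _ (i₂ : F →+* Ult K₂) (i₁ : F →+* Ult K₁) ↦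
      Countable F ∧ SepHom p i₁ ∧ SepHom p i₂ := fun F _ i₂ i₁ h a ↦ by
    obtain ⟨F', hF', j, i₁', i₂', ⟨h, h', h''⟩, hj⟩ :=
      forthProperty_sepHom h₁ F i₂ i₁ ⟨h.1, h.2.2, h.2.1⟩ a
    exact ⟨F', hF', j, i₁', i₂', ⟨h, h'', h'⟩, hj⟩
  have key : Ult K₁ ≅[Language.ring] Ult K₂ :=
    elementarilyEquivalent_of_backAndForth (forthProperty_sepHom h₂) back (ZMod p)
      (algebraMap _ _) (algebraMap _ _)
      ⟨inferInstance, macLane_of_perfectField.sepHom, macLane_of_perfectField.sepHom⟩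
  exact (germ_elementarilyEquivalent.trans key).trans germ_elementarilyEquivalent.symm
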